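/- arXiv:2603.16849 — 6 statements merged into one kernel-verified Lean document; each statement's English description precedes it below -/
import Mathlib

section
/- Johnson–Lindenstrauss norm concentration for Gaussian random projections: There exists a constant c > 0 such that for all positive natural numbers r and N, for every nonzero v ∈ (Fin N → ℝ), and every ε ∈ (0,1), if R is a random r × N matrix whose entries are independent centered Gaussians of variance 1/r (i.e., R is distributed according to the product over Fin r × Fin N of the Gaussian measure on ℝ with mean 0 and variance 1/r), then the probability of the event { R : | ‖R.mulVec v‖² − ‖v‖² | > ε ‖v‖² } is at most 2 · exp(−c · ε² · r), where ‖·‖ denotes the Euclidean norm. -/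
open MeasureTheory ProbabilityTheory
open scoped NNReal

namespace GaussianProjection

lemma neg_half_log_one_sub_le {x : ℝ} (hx : |x| ≤ 1 / 2) :
    -(1 / 2) * Real.log (1 - x) ≤ x / 2 + x ^ 2 := by
  have h := Real.abs_log_sub_add_sum_range_le (x := x) (by linarith) 1
  simp only [Finset.sum_range_one, zero_add, pow_one, Nat.cast_zero, div_one, sq_abs,
    one_add_one_eq_two] at h
  have h2 : x ^ 2 / (1 - |x|) ≤ 2 * x ^ 2 := by
    rw [div_le_iff₀ (by linarith)]
    nlinarith [sq_nonneg x]
  have h3 := (abs_le.mp h).1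
  linarith

lemma gaussianPDFReal_mul_exp_sq {s : ℝ≥0} (hs : s ≠ 0) (t x : ℝ) :
    gaussianPDFReal 0 s x * Real.exp (t * x ^ 2)
      = (√(2 * Real.pi * s))⁻¹ * Real.exp (-((1 - 2 * t * s) / (2 * s)) * x ^ 2) := by
  have hs' : (s : ℝ) ≠ 0 := by exact_mod_cast hs
  rw [gaussianPDFReal, mul_assoc, ← Real.exp_add]
  congr 2
  field_simp
  ring

lemma integrable_exp_mul_sq_gaussianReal {s : ℝ≥0} (hs : s ≠ 0) {t : ℝ} (ht : 2 * t * s < 1) :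
    Integrable (fun x ↦ Real.exp (t * x ^ 2)) (gaussianReal 0 s) := by
  have hs' : 0 < (s : ℝ) := by exact_mod_cast pos_iff_ne_zero.mpr hs
  rw [gaussianReal_of_var_ne_zero 0 hs, integrable_withDensity_iff_integrable_smul'
    (measurable_gaussianPDF _ _) (ae_of_all _ fun _ ↦ gaussianPDF_lt_top)]
  simp only [toReal_gaussianPDF, smul_eq_mul, gaussianPDFReal_mul_exp_sq hs]
  exact (integrable_exp_neg_mul_sq (div_pos (by linarith) (by positivity))).const_mul _

lemma integral_exp_mul_sq_gaussianReal {s : ℝ≥0} (hs : s ≠ 0) {t : ℝ} (ht : 2 * t * s < 1) :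
    ∫ x, Real.exp (t * x ^ 2) ∂(gaussianReal 0 s)
      = Real.exp (-(1 / 2) * Real.log (1 - 2 * t * s)) := by
  have hs' : 0 < (s : ℝ) := by exact_mod_cast pos_iff_ne_zero.mpr hs
  have hpos : 0 < 1 - 2 * t * s := by linarith
  simp only [integral_gaussianReal_eq_integral_smul hs, smul_eq_mul,
    gaussianPDFReal_mul_exp_sq hs]
  rw [integral_const_mul, integral_gaussian, ← Real.sqrt_inv, ← Real.sqrt_mul (by positivity)]
  have h : (2 * Real.pi * s)⁻¹ * (Real.pi / ((1 - 2 * t * s) / (2 * s)))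
      = Real.exp (-Real.log (1 - 2 * t * s)) := by
    rw [Real.exp_neg, Real.exp_log hpos]
    have := Real.pi_pos
    field_simp
  rw [h, Real.sqrt_eq_iff_mul_self_eq (by positivity) (by positivity), ← Real.exp_add]
  ring_nf

variable {Ω : Type*} {mΩ : MeasurableSpace Ω} {P : Measure Ω}

/-- Squares of centered Gaussian variables have sub-exponential moment generating functions. -/
lemma mgf_sq_le {Y : Ω → ℝ} {s : ℝ≥0} (hs : s ≠ 0) (hY : HasLaw Y (gaussianReal 0 s) P)
    {t : ℝ} (ht : |2 * t * s| ≤ 1 / 2) :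
    mgf (fun ω ↦ Y ω ^ 2) P t ≤ Real.exp (t * s + 4 * (t * s) ^ 2) := by
  have ht' : 2 * t * s < 1 := by linarith [le_abs_self (2 * t * s)]
  have h := hY.integral_comp (f := fun x ↦ Real.exp (t * x ^ 2)) (by fun_prop)
  rw [mgf]
  simp only [Function.comp_def] at h
  rw [h, integral_exp_mul_sq_gaussianReal hs ht']
  gcongr
  refine (neg_half_log_one_sub_le ht).trans_eq ?_
  ring

lemma integrable_exp_mul_sq {Y : Ω → ℝ} {s : ℝ≥0} (hs : s ≠ 0)
    (hY : HasLaw Y (gaussianReal 0 s) P) {t : ℝ} (ht : |2 * t * s| ≤ 1 / 2) :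
    Integrable (fun ω ↦ Real.exp (t * Y ω ^ 2)) P := by
  have ht' : 2 * t * s < 1 := by linarith [le_abs_self (2 * t * s)]
  have h := integrable_exp_mul_sq_gaussianReal hs ht'
  rw [← hY.map_eq] at h
  exact h.comp_aemeasurable hY.aemeasurable

/-- Concentration of a sum of squares of i.i.d. centered Gaussian variables around its mean. -/
lemma measureReal_abs_sum_sq_sub_le {ι : Type*} [Fintype ι] [IsProbabilityMeasure P]
    {Y : ι → Ω → ℝ} {s : ℝ≥0} (hs : s ≠ 0) (hm : ∀ i, Measurable (Y i))
    (hY : ∀ i, HasLaw (Y i) (gaussianReal 0 s) P) (hind : iIndepFun Y P)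
    {ε : ℝ} (hε : 0 ≤ ε) (hε1 : ε ≤ 1) :
    P.real {ω | ε * (Fintype.card ι * s) ≤ |∑ i, Y i ω ^ 2 - Fintype.card ι * s|}
      ≤ 2 * Real.exp (-(1 / 16) * ε ^ 2 * Fintype.card ι) := by
  have hs' : 0 < (s : ℝ) := by exact_mod_cast pos_iff_ne_zero.mpr hs
  set n : ℝ := (Fintype.card ι : ℝ)
  have hind2 : iIndepFun (fun i ω ↦ Y i ω ^ 2) P :=
    hind.comp (fun _ x ↦ x ^ 2) fun _ ↦ by fun_prop
  have hm2 : ∀ i, Measurable fun ω ↦ Y i ω ^ 2 := fun i ↦ (hm i).pow_const 2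
  have key : ∀ t : ℝ, |2 * t * s| ≤ 1 / 2 →
      Integrable (fun ω ↦ Real.exp (t * (∑ i, fun ω ↦ Y i ω ^ 2) ω)) P ∧
      mgf (∑ i, fun ω ↦ Y i ω ^ 2) P t ≤ Real.exp (n * (t * s + 4 * (t * s) ^ 2)) := by
    intro t ht
    refine ⟨hind2.integrable_exp_mul_sum hm2 fun i _ ↦ integrable_exp_mul_sq hs (hY i) ht, ?_⟩
    rw [hind2.mgf_sum hm2, Real.exp_nat_mul]
    exact (Finset.prod_le_prod (fun _ _ ↦ mgf_nonneg) fun i _ ↦ mgf_sq_le hs (hY i) ht).trans_eq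
      (by rw [Finset.prod_const, Finset.card_univ])
  have hle : ε / 8 / s * s = ε / 8 := by field_simp
  have hsmall : |2 * (ε / 8 / s) * s| ≤ 1 / 2 := by
    rw [mul_assoc, hle, abs_of_nonneg (by positivity)]
    linarith
  have hsmall' : |2 * (-(ε / 8 / s)) * s| ≤ 1 / 2 := by
    rwa [mul_neg, neg_mul, abs_neg]
  obtain ⟨hi, hb⟩ := key _ hsmall
  obtain ⟨hi', hb'⟩ := key _ hsmall'
  have hup := (measure_ge_le_exp_mul_mgf ((1 + ε) * (n * s)) (by positivity) hi).trans
    (mul_le_mul_of_nonneg_left hb (Real.exp_pos _).le)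
  have hlo := (measure_le_le_exp_mul_mgf ((1 - ε) * (n * s))
    (by rw [neg_nonpos]; positivity) hi').trans
    (mul_le_mul_of_nonneg_left hb' (Real.exp_pos _).le)
  rw [← Real.exp_add] at hup hlo
  have e1 : -(ε / 8 / s) * ((1 + ε) * (n * s))
      + n * (ε / 8 / s * s + 4 * (ε / 8 / s * s) ^ 2) = -(1 / 16) * ε ^ 2 * n := by
    field_simp
    ring
  have e2 : -(-(ε / 8 / s)) * ((1 - ε) * (n * s))
      + n * (-(ε / 8 / s) * s + 4 * (-(ε / 8 / s) * s) ^ 2) = -(1 / 16) * ε ^ 2 * n := by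
    field_simp
    ring
  rw [e1] at hup
  rw [e2] at hlo
  simp only [Finset.sum_apply] at hup hlo
  rw [two_mul]
  refine le_trans ?_ ((measureReal_union_le _ _).trans (add_le_add hup hlo))
  refine measureReal_mono fun ω hω ↦ ?_
  simp only [Set.mem_ofPred_eq, Set.mem_union] at hω ⊢
  rcases le_abs.mp hω with h | h
  · left; linarith
  · right; linarith

lemma measurable_dotProduct {κ : Type*} [Fintype κ] (v : κ → ℝ) :
    Measurable fun x : κ → ℝ ↦ x ⬝ᵥ v := by
  simp only [dotProduct]
  fun_prop

/-- A linear form in i.i.d. centered Gaussian coordinates is a centered Gaussian variable. -/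
lemma hasLaw_dotProduct_gaussianReal {κ : Type*} [Fintype κ] (s : ℝ≥0) (v : κ → ℝ) :
    HasLaw (fun x : κ → ℝ ↦ x ⬝ᵥ v) (gaussianReal 0 (s * ∑ j, ‖v j‖₊ ^ 2))
      (Measure.pi fun _ : κ ↦ gaussianReal 0 s) := by
  refine ⟨(measurable_dotProduct v).aemeasurable, Measure.ext_of_charFun ?_⟩
  have hind : iIndepFun (fun (j : κ) (x : κ → ℝ) ↦ x j * v j)
      (Measure.pi fun _ : κ ↦ gaussianReal 0 s) :=
    iIndepFun_pi (X := fun j x ↦ x * v j) fun _ ↦ by fun_prop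
  have hlaw : ∀ j, (Measure.pi fun _ : κ ↦ gaussianReal 0 s).map (fun x ↦ x j * v j)
      = gaussianReal 0 (s * ‖v j‖₊ ^ 2) := by
    intro j
    have h := gaussianReal_map_mul_const (μ := 0) (v := s) (v j)
    rw [← (measurePreserving_eval (fun _ : κ ↦ gaussianReal 0 s) j).map_eq,
      Measure.map_map (by fun_prop) (by fun_prop)] at h
    refine h.trans ?_
    congr 1
    · simp
    · ext
      simp [mul_comm]
  have hsum := hind.charFun_map_fun_sum_eq_prod fun j ↦ ((measurable_pi_apply j).mul_const _).aemeasurable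
  simp only [dotProduct]
  rw [hsum]
  ext t
  simp only [hlaw, Finset.prod_apply, charFun_gaussianReal, ← Complex.exp_sum]
  congr 1
  push_cast
  simp only [mul_zero, zero_mul, zero_sub, Finset.sum_neg_distrib, Finset.mul_sum, Finset.sum_mul,
    Finset.sum_div]

lemma map_curry_pi {ι κ X : Type*} [Fintype ι] [Fintype κ] [MeasurableSpace X]
    (μ : Measure X) [IsProbabilityMeasure μ] :
    (Measure.pi fun _ : ι × κ ↦ μ).map (MeasurableEquiv.curry ι κ X)
      = Measure.pi fun _ : ι ↦ Measure.pi fun _ : κ ↦ μ := by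
  simp only [← Measure.infinitePi_eq_pi]
  exact Measure.infinitePi_map_curry (fun _ _ ↦ μ)

end GaussianProjection

/-- Johnson–Lindenstrauss norm concentration for Gaussian random projections:
for a random `r × N` matrix with i.i.d. centered Gaussian entries of variance
`1/r`, the squared Euclidean norm of `R v` concentrates around `‖v‖²`. -/
theorem jl_norm_concentration_gaussian :
    ∃ c : ℝ, 0 < c ∧
      ∀ (r N : ℕ), 0 < r → 0 < N →
        ∀ v : Fin N → ℝ, v ≠ 0 →
          ∀ ε : ℝ, ε ∈ Set.Ioo (0 : ℝ) 1 →
            (Measure.pi fun _ : Fin r × Fin N => gaussianReal 0 ((r : ℝ≥0))⁻¹)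
              {R | ε * ‖(EuclideanSpace.equiv (Fin N) ℝ).symm v‖ ^ 2 <
                |‖(EuclideanSpace.equiv (Fin r) ℝ).symm
                    ((Matrix.of fun i j => R (i, j)).mulVec v)‖ ^ 2 -
                  ‖(EuclideanSpace.equiv (Fin N) ℝ).symm v‖ ^ 2|}
              ≤ ENNReal.ofReal (2 * Real.exp (-c * ε ^ 2 * r)) := by
  refine ⟨1 / 16, by norm_num, fun r N hr _ v hv ε hε ↦ ?_⟩
  have hr' : (r : ℝ) ≠ 0 := by positivity
  set s : ℝ≥0 := (r : ℝ≥0)⁻¹ * ∑ j, ‖v j‖₊ ^ 2 with hs_def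
  have hnorm : ‖(EuclideanSpace.equiv (Fin N) ℝ).symm v‖ ^ 2 = r * (s : ℝ) := by
    simp [EuclideanSpace.norm_sq_eq, hs_def, hr']
  have hs : s ≠ 0 := by
    obtain ⟨j, hj⟩ := Function.ne_iff.mp hv
    have : 0 < ∑ j, ‖v j‖₊ ^ 2 :=
      Finset.sum_pos' (fun _ _ ↦ zero_le) ⟨j, Finset.mem_univ j, by
        have : 0 < ‖v j‖₊ := nnnorm_pos.mpr hj
        positivity⟩
    positivity
  set ν := Measure.pi fun _ : Fin N ↦ gaussianReal 0 (r : ℝ≥0)⁻¹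
  have hbound := GaussianProjection.measureReal_abs_sum_sq_sub_le
    (P := Measure.pi fun _ : Fin r ↦ ν) (Y := fun i A ↦ A i ⬝ᵥ v) hs
    (fun i ↦ (GaussianProjection.measurable_dotProduct v).comp (measurable_pi_apply i))
    (fun i ↦ (GaussianProjection.hasLaw_dotProduct_gaussianReal _ v).comp
      (measurePreserving_eval (fun _ : Fin r ↦ ν) i).hasLaw)
    (iIndepFun_pi (X := fun _ x ↦ x ⬝ᵥ v) fun _ ↦
      (GaussianProjection.measurable_dotProduct v).aemeasurable)
    hε.1.le hε.2.le
  rw [Fintype.card_fin] at hbound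
  rw [← GaussianProjection.map_curry_pi, measureReal_def, MeasurableEquiv.map_apply] at hbound
  rw [hnorm]
  refine (measure_mono fun R hR ↦ ?_).trans
    (ENNReal.le_ofReal_iff_toReal_le (measure_ne_top _ _) (by positivity) |>.mpr hbound)
  simp only [Set.mem_ofPred_eq, EuclideanSpace.norm_sq_eq] at hR
  simp only [PiLp.continuousLinearEquiv_symm_apply, Real.norm_eq_abs, sq_abs] at hR
  exact hR.le
end

section
/- Johnson–Lindenstrauss inner-product concentration for Gaussian random projections: There exist constants C, c > 0 such that for all positive natural numbers r and N, for all v, w ∈ (Fin N → ℝ), and every ε ∈ (0,1), if R is a random r × N matrix whose entries are independent centered Gaussians of variance 1/r, then the probability of the event { R : | ⟨R.mulVec v, R.mulVec w⟩ − ⟨v, w⟩ | > ε ‖v‖ ‖w‖ } is at most C · exp(−c · ε² · r), where ⟨·,·⟩ and ‖·‖ denote the Euclidean inner product and norm. -/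
open MeasureTheory ProbabilityTheory Matrix
open scoped NNReal

/-- The moment-generating function of the square of a centered Gaussian. -/
lemma mgf_sq_gaussianReal {V : ℝ≥0} (hV : V ≠ 0) {t : ℝ} (ht : 2 * V * t < 1) :
    mgf (fun x : ℝ => x ^ 2) (gaussianReal 0 V) t = √(1 - 2 * V * t)⁻¹ := by
  have hV' : (0 : ℝ) < V := by positivity
  have h1 : 0 < 1 - 2 * V * t := by linarith
  have hpi := Real.pi_pos
  have key : ∀ x : ℝ, gaussianPDFReal 0 V x • Real.exp (t * x ^ 2)
      = (√(2 * Real.pi * V))⁻¹ * Real.exp (-((1 - 2 * V * t) / (2 * V)) * x ^ 2) := by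
    intro x
    rw [gaussianPDFReal, smul_eq_mul, mul_assoc, ← Real.exp_add]
    congr 2
    field_simp
    ring
  rw [mgf, integral_gaussianReal_eq_integral_smul hV]
  simp_rw [key]
  rw [integral_const_mul, integral_gaussian, ← Real.sqrt_inv, ← Real.sqrt_mul (by positivity)]
  congr 1
  field_simp

lemma integrable_exp_mul_sq_gaussianReal {V : ℝ≥0} (hV : V ≠ 0) {t : ℝ} (ht : 2 * V * t < 1) :
    Integrable (fun x : ℝ => Real.exp (t * x ^ 2)) (gaussianReal 0 V) := by
  rw [← mgf_pos_iff (X := fun x : ℝ => x ^ 2), mgf_sq_gaussianReal hV ht]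
  have : 0 < 1 - 2 * V * t := by linarith
  positivity

lemma mgf_sq_gaussianReal_le {V : ℝ≥0} (hV : V ≠ 0) {t : ℝ} (ht : 4 * V * t ≤ 1) :
    mgf (fun x : ℝ => x ^ 2) (gaussianReal 0 V) t ≤ Real.exp (V * t + 4 * (V * t) ^ 2) := by
  set y : ℝ := V * t with hy
  have h1 : 0 < 1 - 2 * y := by linarith
  rw [mgf_sq_gaussianReal hV (by linarith), Real.sqrt_le_left (Real.exp_pos _).le,
    ← Real.exp_nat_mul, show 1 - 2 * V * t = 1 - 2 * y by rw [hy]; ring]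
  refine le_trans ?_ (Real.add_one_le_exp _)
  rw [inv_le_iff_one_le_mul₀ h1]
  push_cast
  nlinarith [mul_nonneg (sq_nonneg y) (show 0 ≤ 1 - 4 * y by linarith)]

section SumOfSquares

variable {ι : Type*} [Fintype ι]

lemma iIndepFun_sq_pi_gaussianReal (V : ℝ≥0) :
    iIndepFun (fun (i : ι) (x : ι → ℝ) => x i ^ 2) (Measure.pi fun _ : ι => gaussianReal 0 V) :=
  iIndepFun_pi (X := fun _ (y : ℝ) => y ^ 2) fun _ => by fun_prop

lemma mgf_sum_sq_pi_gaussianReal_eq (V : ℝ≥0) (t : ℝ) :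
    mgf (∑ i, fun x : ι → ℝ => x i ^ 2) (Measure.pi fun _ : ι => gaussianReal 0 V) t
      = mgf (fun x : ℝ => x ^ 2) (gaussianReal 0 V) t ^ Fintype.card ι := by
  rw [(iIndepFun_sq_pi_gaussianReal V).mgf_sum (fun i => by fun_prop), ← Finset.card_univ,
    ← Finset.prod_const]
  refine Finset.prod_congr rfl fun i _ => ?_
  have h := measurePreserving_eval (fun _ : ι => gaussianReal 0 V) i
  conv_rhs => rw [← h.map_eq]
  rw [mgf_map h.measurable.aemeasurable (by fun_prop)]
  rfl

lemma integrable_exp_mul_sum_sq_pi_gaussianReal {V : ℝ≥0} (hV : V ≠ 0) {t : ℝ}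
    (ht : 2 * V * t < 1) :
    Integrable (fun x => Real.exp (t * (∑ i, fun x : ι → ℝ => x i ^ 2) x))
      (Measure.pi fun _ : ι => gaussianReal 0 V) := by
  refine (iIndepFun_sq_pi_gaussianReal V).integrable_exp_mul_sum (fun i => by fun_prop)
    fun i _ => ?_
  exact (measurePreserving_eval (fun _ : ι => gaussianReal 0 V) i).integrable_comp_of_integrable
    (integrable_exp_mul_sq_gaussianReal hV ht)

lemma exp_mul_mgf_sum_sq_pi_gaussianReal_le {V : ℝ≥0} (hV : V ≠ 0) {y : ℝ} (hy : 4 * y ≤ 1)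
    (a : ℝ) :
    Real.exp (-(y / V) * ((1 + a) * (Fintype.card ι * V))) *
        mgf (∑ i, fun x : ι → ℝ => x i ^ 2) (Measure.pi fun _ : ι => gaussianReal 0 V) (y / V)
      ≤ Real.exp (Fintype.card ι * (4 * y ^ 2 - a * y)) := by
  have hV' : (V : ℝ) ≠ 0 := by simpa using hV
  have hVy : (V : ℝ) * (y / V) = y := by field_simp
  have h := mgf_sq_gaussianReal_le hV (t := y / V) (by rw [mul_assoc, hVy]; exact hy)
  rw [hVy] at h
  rw [mgf_sum_sq_pi_gaussianReal_eq]
  calc _ ≤ Real.exp (-(y / V) * ((1 + a) * (Fintype.card ι * V))) *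
        Real.exp (y + 4 * y ^ 2) ^ Fintype.card ι := by
        gcongr
        exact mgf_nonneg
    _ = _ := by
        rw [← Real.exp_nat_mul, ← Real.exp_add]
        congr 1
        field_simp
        ring

/-- Two-sided chi-square tail bound. -/
lemma measureReal_abs_sum_sq_sub_ge_le {V : ℝ≥0} (hV : V ≠ 0) {δ : ℝ} (hδ : δ ∈ Set.Ioo (0 : ℝ) 1) :
    (Measure.pi fun _ : ι => gaussianReal 0 V).real
        {x | δ * (Fintype.card ι * V) ≤ |∑ i, x i ^ 2 - Fintype.card ι * V|}
      ≤ 2 * Real.exp (-(1 / 16) * δ ^ 2 * Fintype.card ι) := by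
  obtain ⟨h0, h1⟩ := hδ
  have hV' : (0 : ℝ) < V := by positivity
  set P := Measure.pi fun _ : ι => gaussianReal 0 V
  set X : (ι → ℝ) → ℝ := ∑ i, fun x : ι → ℝ => x i ^ 2 with hX
  have int (y : ℝ) (hy : 4 * y ≤ 1) : Integrable (fun x => Real.exp (y / V * X x)) P :=
    integrable_exp_mul_sum_sq_pi_gaussianReal hV (by
      rw [mul_assoc, mul_div_cancel₀ _ hV'.ne']; linarith)
  have upper := (measure_ge_le_exp_mul_mgf ((1 + δ) * (Fintype.card ι * V))
    (by positivity) (int (δ / 8) (by linarith))).trans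
      (exp_mul_mgf_sum_sq_pi_gaussianReal_le hV (by linarith) δ)
  have lower := (measure_le_le_exp_mul_mgf ((1 + -δ) * (Fintype.card ι * V))
    (div_nonpos_of_nonpos_of_nonneg (by linarith) hV'.le) (int (-δ / 8) (by linarith))).trans
      (exp_mul_mgf_sum_sq_pi_gaussianReal_le hV (by linarith) (-δ))
  have hsub : {x : ι → ℝ | δ * (Fintype.card ι * V) ≤ |∑ i, x i ^ 2 - Fintype.card ι * V|}
      ⊆ {x | (1 + δ) * (Fintype.card ι * V) ≤ X x} ∪
        {x | X x ≤ (1 + -δ) * (Fintype.card ι * V)} := by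
    intro x hx
    have hXx : X x = ∑ i, x i ^ 2 := by simp [hX]
    rcases le_abs.1 (Set.mem_ofPred_eq ▸ hx) with h | h
    · left; change _ ≤ X x; linarith
    · right; change X x ≤ _; linarith
  refine (measureReal_mono hsub).trans ((measureReal_union_le _ _).trans
    ((add_le_add upper lower).trans_eq ?_))
  rw [two_mul]
  congr 2 <;> ring

end SumOfSquares

section LinearImage

variable {ι κ : Type*} [Fintype ι] [Fintype κ]

/-- A linear form in i.i.d. centered Gaussians is a centered Gaussian. -/
lemma map_dotProduct_pi_gaussianReal (V : ℝ≥0) (u : κ → ℝ) :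
    (Measure.pi fun _ : κ => gaussianReal 0 V).map (fun x => x ⬝ᵥ u)
      = gaussianReal 0 (V * (u ⬝ᵥ u).toNNReal) := by
  have hm : Measurable fun x : κ → ℝ => x ⬝ᵥ u := by
    unfold dotProduct; fun_prop
  refine Measure.ext_of_charFun (funext fun t => ?_)
  rw [charFun_apply_real, integral_map hm.aemeasurable (by fun_prop)]
  have key : ∀ x : κ → ℝ, Complex.exp (t * ((x ⬝ᵥ u : ℝ) : ℂ) * Complex.I)
      = ∏ j, Complex.exp (((t * u j : ℝ) : ℂ) * x j * Complex.I) := by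
    intro x
    rw [← Complex.exp_sum, dotProduct]
    push_cast
    rw [Finset.mul_sum, Finset.sum_mul]
    congr 1
    exact Finset.sum_congr rfl fun j _ => by ring
  simp_rw [key]
  rw [integral_fintype_prod_eq_prod
    (f := fun j (y : ℝ) => Complex.exp (((t * u j : ℝ) : ℂ) * y * Complex.I))]
  simp_rw [← charFun_apply_real, charFun_gaussianReal]
  have hu : 0 ≤ u ⬝ᵥ u := Finset.sum_nonneg fun i _ => mul_self_nonneg (u i)
  rw [← Complex.exp_sum, NNReal.coe_mul, Real.coe_toNNReal _ hu, dotProduct]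
  push_cast
  simp only [mul_zero, zero_mul, zero_sub, Finset.mul_sum, Finset.sum_mul, Finset.sum_div,
    Finset.sum_neg_distrib]
  congr 2
  exact Finset.sum_congr rfl fun j _ => by ring

lemma measurePreserving_curry_pi {α : Type*} [MeasurableSpace α] (μ : Measure α)
    [IsProbabilityMeasure μ] :
    MeasurePreserving (fun (R : ι × κ → α) i j => R (i, j)) (Measure.pi fun _ => μ)
      (Measure.pi fun _ => Measure.pi fun _ => μ) := by
  have hc : Measurable fun (R : ι × κ → α) i j => R (i, j) := by fun_prop
  have hu : Measurable fun (S : ι → κ → α) (p : ι × κ) => S p.1 p.2 := by fun_prop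
  refine ⟨hc, ?_⟩
  have h : (Measure.pi fun _ : ι × κ => μ)
      = (Measure.pi fun _ : ι => Measure.pi fun _ : κ => μ).map fun S p => S p.1 p.2 := by
    refine Measure.pi_eq fun s hs => ?_
    rw [Measure.map_apply hu (MeasurableSet.univ_pi hs)]
    have : (fun (S : ι → κ → α) (p : ι × κ) => S p.1 p.2) ⁻¹' Set.univ.pi s
        = Set.univ.pi fun i => Set.univ.pi fun j => s (i, j) := by
      ext S
      simp [Prod.forall]
    rw [this]
    simp_rw [Measure.pi_pi]
    rw [Fintype.prod_prod_type]
  rw [h, Measure.map_map hc hu]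
  exact Measure.map_id

/-- The image of a fixed vector under a matrix with i.i.d. centered Gaussian entries has
i.i.d. centered Gaussian coordinates. -/
lemma measurePreserving_mulVec_gaussianReal (V : ℝ≥0) (u : κ → ℝ) :
    MeasurePreserving (fun (R : ι × κ → ℝ) => (Matrix.of fun i j => R (i, j)).mulVec u)
      (Measure.pi fun _ => gaussianReal 0 V)
      (Measure.pi fun _ => gaussianReal 0 (V * (u ⬝ᵥ u).toNNReal)) := by
  have hm : Measurable fun x : κ → ℝ => x ⬝ᵥ u := by
    unfold dotProduct; fun_prop
  exact (measurePreserving_pi _ _ fun _ : ι =>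
    ⟨hm, map_dotProduct_pi_gaussianReal V u⟩).comp (measurePreserving_curry_pi _)

end LinearImage

/-- Concentration of the squared norm of a Gaussian random projection. -/
lemma measure_abs_mulVec_dotProduct_self_sub_gt_le {ι κ : Type*} [Fintype ι] [Nonempty ι]
    [Fintype κ] (u : κ → ℝ) {δ : ℝ} (hδ : δ ∈ Set.Ioo (0 : ℝ) 1) :
    (Measure.pi fun _ : ι × κ => gaussianReal 0 (Fintype.card ι : ℝ≥0)⁻¹)
        {R | δ * (u ⬝ᵥ u) < |((Matrix.of fun i j => R (i, j)).mulVec u) ⬝ᵥ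
          ((Matrix.of fun i j => R (i, j)).mulVec u) - u ⬝ᵥ u|}
      ≤ ENNReal.ofReal (2 * Real.exp (-(1 / 16) * δ ^ 2 * Fintype.card ι)) := by
  by_cases hu : u = 0
  · simp [hu]
  have hs : 0 < u ⬝ᵥ u :=
    lt_of_le_of_ne (Finset.sum_nonneg fun i _ => mul_self_nonneg (u i))
      (Ne.symm (dotProduct_self_eq_zero.not.2 hu))
  have hn : (Fintype.card ι : ℝ) ≠ 0 := by simp
  set V : ℝ≥0 := (Fintype.card ι : ℝ≥0)⁻¹ * (u ⬝ᵥ u).toNNReal with hVdef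
  have hV : V ≠ 0 := by simp [hVdef, hs]
  have hcard : Fintype.card ι * (V : ℝ) = u ⬝ᵥ u := by
    rw [hVdef]
    push_cast
    rw [Real.coe_toNNReal _ hs.le, mul_inv_cancel_left₀ hn]
  have key := measureReal_abs_sum_sq_sub_ge_le (ι := ι) hV hδ
  rw [hcard] at key
  have hms : MeasurableSet {x : ι → ℝ | δ * (u ⬝ᵥ u) ≤ |∑ i, x i ^ 2 - u ⬝ᵥ u|} :=
    measurableSet_le (by fun_prop) (by fun_prop)
  refine le_trans (measure_mono ?_) (((measurePreserving_mulVec_gaussianReal (ι := ι)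
    (Fintype.card ι : ℝ≥0)⁻¹ u).measure_preimage hms.nullMeasurableSet).trans_le
      (ENNReal.le_ofReal_iff_toReal_le (measure_ne_top _ _) (by positivity) |>.2 key))
  intro R hR
  simpa only [Set.mem_preimage, Set.mem_ofPred_eq, dotProduct, sq] using le_of_lt hR

lemma dotProduct_self_add_smul {R n : Type*} [CommRing R] [Fintype n] (a b : R) (v w : n → R) :
    (b • v + a • w) ⬝ᵥ (b • v + a • w)
      = b ^ 2 * (v ⬝ᵥ v) + 2 * (a * b) * (v ⬝ᵥ w) + a ^ 2 * (w ⬝ᵥ w) := by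
  simp only [add_dotProduct, dotProduct_add, smul_dotProduct, dotProduct_smul, smul_eq_mul,
    dotProduct_comm w v]
  ring

/-- Weighted polarization: a large deviation of the inner product forces a large deviation of
the squared norm of one of the vectors `b v ± a w`, where `a` and `b` are the norms of `v`
and `w`. -/
lemma exists_dotProduct_self_deviation {m n : Type*} [Fintype m] [Fintype n] (A : Matrix m n ℝ)
    (v w : n → ℝ) {a b ε : ℝ} (ha : 0 ≤ a) (hb : 0 ≤ b) (hv : a ^ 2 = v ⬝ᵥ v)
    (hw : b ^ 2 = w ⬝ᵥ w) (h : ε * a * b < |A.mulVec v ⬝ᵥ A.mulVec w - v ⬝ᵥ w|) :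
    ∃ u ∈ ({b • v + a • w, b • v + (-a) • w} : Set (n → ℝ)),
      ε / 2 * (u ⬝ᵥ u) < |A.mulVec u ⬝ᵥ A.mulVec u - u ⬝ᵥ u| := by
  by_cases hab : a * b = 0
  · exfalso
    rcases mul_eq_zero.1 hab with h0 | h0
    · have : v = 0 := dotProduct_self_eq_zero.1 (by rw [← hv, h0]; simp)
      simp [this, h0] at h
    · have : w = 0 := dotProduct_self_eq_zero.1 (by rw [← hw, h0]; simp)
      simp [this, h0] at h
  have hpos : 0 < a * b := lt_of_le_of_ne (by positivity) (Ne.symm hab)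
  by_contra! hcon
  have hp := hcon _ (Or.inl rfl)
  have hm := hcon _ (Or.inr rfl)
  simp only [mulVec_add, mulVec_smul, dotProduct_self_add_smul] at hp hm
  set p := A.mulVec v ⬝ᵥ A.mulVec v
  set q := A.mulVec v ⬝ᵥ A.mulVec w
  set s := A.mulVec w ⬝ᵥ A.mulVec w
  set d := v ⬝ᵥ w
  rw [← hv, ← hw] at hp hm
  have hp' := abs_le.1 hp
  have hm' := abs_le.1 hm
  rcases lt_abs.1 h with h | h
  · nlinarith [mul_lt_mul_of_pos_left h hpos, hp'.2, hm'.1]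
  · nlinarith [mul_lt_mul_of_pos_left h hpos, hp'.1, hm'.2]

/-- Johnson–Lindenstrauss inner-product concentration for Gaussian random
projections: for a random `r × N` matrix with i.i.d. centered Gaussian entries
of variance `1/r`, the Euclidean inner product of `R v` and `R w` concentrates
around `⟨v, w⟩`. -/
theorem jl_inner_product_concentration_gaussian :
    ∃ C c : ℝ, 0 < C ∧ 0 < c ∧
      ∀ (r N : ℕ), 0 < r → 0 < N →
        ∀ v w : Fin N → ℝ,
          ∀ ε : ℝ, ε ∈ Set.Ioo (0 : ℝ) 1 →
            (Measure.pi fun _ : Fin r × Fin N => gaussianReal 0 ((r : ℝ≥0))⁻¹)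
              {R | ε * ‖(EuclideanSpace.equiv (Fin N) ℝ).symm v‖ *
                    ‖(EuclideanSpace.equiv (Fin N) ℝ).symm w‖ <
                |((Matrix.of fun i j => R (i, j)).mulVec v) ⬝ᵥ
                    ((Matrix.of fun i j => R (i, j)).mulVec w) - v ⬝ᵥ w|}
              ≤ ENNReal.ofReal (C * Real.exp (-c * ε ^ 2 * r)) := by
  refine ⟨4, 1 / 64, by norm_num, by norm_num, fun r N hr _ v w ε hε => ?_⟩
  have : NeZero r := ⟨hr.ne'⟩
  have hnorm (x : Fin N → ℝ) : ‖(EuclideanSpace.equiv (Fin N) ℝ).symm x‖ ^ 2 = x ⬝ᵥ x := by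
    rw [EuclideanSpace.real_norm_sq_eq]
    simp [dotProduct, sq]
  set a := ‖(EuclideanSpace.equiv (Fin N) ℝ).symm v‖
  set b := ‖(EuclideanSpace.equiv (Fin N) ℝ).symm w‖
  have bound (u : Fin N → ℝ) := measure_abs_mulVec_dotProduct_self_sub_gt_le (ι := Fin r) u
    (δ := ε / 2) ⟨by linarith [hε.1], by linarith [hε.2]⟩
  simp only [Fintype.card_fin] at bound
  refine (measure_mono (t := _ ∪ _) ?_).trans ((measure_union_le _ _).trans
    ((add_le_add (bound (b • v + a • w)) (bound (b • v + (-a) • w))).trans_eq ?_))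
  · intro R hR
    obtain ⟨u, rfl | rfl, hu⟩ := exists_dotProduct_self_deviation _ v w (norm_nonneg _)
      (norm_nonneg _) (hnorm v) (hnorm w) hR
    · exact Or.inl hu
    · exact Or.inr hu
  · rw [← ENNReal.ofReal_add (by positivity) (by positivity), ← add_mul]
    congr 2
    · norm_num
    · congr 1
      ring
end

section
/- Gauge invariance of exact eigenmap inner products: Let L be an N × N real symmetric positive-semidefinite matrix. Suppose u, u' : Fin N → (Fin N → ℝ) are two orthonormal eigenbases of L with L.mulVec (u k) = λ k • u k and L.mulVec (u' k) = λ' k • u' k, where λ k, λ' k ≥ 0. Then for all i, j: ∑_{k : λ k ≠ 0} (λ k)⁻¹ · (u k) i · (u k) j = ∑_{k : λ' k ≠ 0} (λ' k)⁻¹ · (u' k) i · (u' k) j. Equivalently, the inner products ⟨φ i, φ j⟩ of the Laplacian eigenmaps do not depend on the arbitrary choice of orthonormal eigenbasis (sign flips, eigenspace rotations, or ordering). -/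
open Matrix
open scoped BigOperators

/-- Expansion of a vector in a family whose rank-one projections sum to the identity. -/
theorem apply_eq_sum_dotProduct_mul {n ι : Type*} [Fintype n] [DecidableEq n] [Fintype ι]
    {u : ι → n → ℝ} (hu : ∑ k, vecMulVec (u k) (u k) = (1 : Matrix n n ℝ))
    (x : n → ℝ) (i : n) : x i = ∑ k, (u k ⬝ᵥ x) * u k i := by
  have h : ((∑ k, vecMulVec (u k) (u k)) *ᵥ x) i = x i := by rw [hu, one_mulVec]
  rw [← h, sum_mulVec, Finset.sum_apply]
  simp [vecMulVec_mulVec, mul_comm]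

/-- For a symmetric matrix, two eigenvectors are orthogonal or share their eigenvalue. -/
theorem eigenvalue_mul_dotProduct_eq {n : Type*} [Fintype n] {L : Matrix n n ℝ}
    (hL : L.IsSymm) {v w : n → ℝ} {a b : ℝ} (hv : L *ᵥ v = a • v) (hw : L *ᵥ w = b • w) :
    a * (v ⬝ᵥ w) = b * (v ⬝ᵥ w) := by
  have h : (L *ᵥ v) ⬝ᵥ w = v ⬝ᵥ (L *ᵥ w) := by
    rw [dotProduct_mulVec, ← mulVec_transpose, hL.eq]
  simpa [hv, hw] using h

/-- The spectral sum `∑ f(λ_k) u_k u_kᵀ` does not depend on the eigenbasis. -/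
theorem sum_eigenvalue_mul_eq {n ι κ : Type*} [Fintype n] [DecidableEq n] [Fintype ι] [Fintype κ]
    {L : Matrix n n ℝ} (hL : L.IsSymm) {u : ι → n → ℝ} {v : κ → n → ℝ} {a : ι → ℝ} {b : κ → ℝ}
    (hu : ∀ k, L *ᵥ u k = a k • u k) (hv : ∀ l, L *ᵥ v l = b l • v l)
    (hu1 : ∑ k, vecMulVec (u k) (u k) = (1 : Matrix n n ℝ))
    (hv1 : ∑ l, vecMulVec (v l) (v l) = (1 : Matrix n n ℝ)) (f : ℝ → ℝ) (i j : n) :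
    ∑ k, f (a k) * u k i * u k j = ∑ l, f (b l) * v l i * v l j := by
  have hf : ∀ k l, f (a k) * (u k ⬝ᵥ v l) = f (b l) * (u k ⬝ᵥ v l) := by
    intro k l
    rcases mul_eq_mul_right_iff.mp (eigenvalue_mul_dotProduct_eq hL (hu k) (hv l)) with h | h
    · rw [h]
    · simp [h]
  calc ∑ k, f (a k) * u k i * u k j
      = ∑ k, ∑ l, f (a k) * (u k ⬝ᵥ v l) * u k i * v l j := by
        refine Finset.sum_congr rfl fun k _ => ?_
        rw [apply_eq_sum_dotProduct_mul hv1 (u k) j, Finset.mul_sum]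
        refine Finset.sum_congr rfl fun l _ => ?_
        rw [dotProduct_comm (v l)]
        ring
    _ = ∑ l, ∑ k, f (b l) * (u k ⬝ᵥ v l) * u k i * v l j := by
        rw [Finset.sum_comm]
        simp only [hf]
    _ = ∑ l, f (b l) * v l i * v l j := by
        refine Finset.sum_congr rfl fun l _ => ?_
        rw [apply_eq_sum_dotProduct_mul hu1 (v l) i, Finset.mul_sum, Finset.sum_mul]
        refine Finset.sum_congr rfl fun k _ => ?_
        ring

/-- Since `0⁻¹ = 0`, restricting to nonzero eigenvalues does not change the sum. -/
theorem sum_filter_ne_zero_inv_mul {ι : Type*} [Fintype ι] (a x y : ι → ℝ) :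
    ∑ k ∈ Finset.univ.filter (fun k => a k ≠ 0), (a k)⁻¹ * x k * y k =
      ∑ k, (a k)⁻¹ * x k * y k := by
  refine Finset.sum_filter_of_ne fun k _ hk h => hk ?_
  simp [h]

/-- Gauge invariance of exact eigenmap inner products: the inner products of the
Laplacian eigenmaps of a real symmetric positive-semidefinite matrix `L` do not
depend on the choice of orthonormal eigenbasis (sign flips, eigenspace rotations,
or reorderings produced by numerical eigensolvers). -/
theorem gauge_invariance_exact_eigenmap_inner_products
    (N : ℕ) (L : Matrix (Fin N) (Fin N) ℝ)
    (hpsd : L.PosSemidef)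
    (u u' : Fin N → (Fin N → ℝ)) (lam lam' : Fin N → ℝ)
    (heig : ∀ k, L.mulVec (u k) = lam k • u k)
    (heig' : ∀ k, L.mulVec (u' k) = lam' k • u' k)
    (hnonneg : ∀ k, 0 ≤ lam k) (hnonneg' : ∀ k, 0 ≤ lam' k)
    (horth : ∀ k l, u k ⬝ᵥ u l = if k = l then (1 : ℝ) else 0)
    (horth' : ∀ k l, u' k ⬝ᵥ u' l = if k = l then (1 : ℝ) else 0)
    (hbasis : ∑ k, vecMulVec (u k) (u k) = (1 : Matrix (Fin N) (Fin N) ℝ))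
    (hbasis' : ∑ k, vecMulVec (u' k) (u' k) = (1 : Matrix (Fin N) (Fin N) ℝ))
    (i j : Fin N) :
    ∑ k ∈ Finset.univ.filter (fun k => lam k ≠ 0), (lam k)⁻¹ * u k i * u k j =
      ∑ k ∈ Finset.univ.filter (fun k => lam' k ≠ 0), (lam' k)⁻¹ * u' k i * u' k j := by
  rw [sum_filter_ne_zero_inv_mul lam (fun k => u k i) (fun k => u k j),
    sum_filter_ne_zero_inv_mul lam' (fun k => u' k i) (fun k => u' k j)]
  have hsymm : L.IsSymm := by simpa using hpsd.isHermitian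
  exact sum_eigenvalue_mul_eq hsymm heig heig' hbasis hbasis' (fun t => t⁻¹) i j
end

section
/- Attention output stability under logit perturbation: Let N, d be positive natural numbers, let a, b : Fin N → ℝ be logits with |a j − b j| ≤ δ for all j and some δ ≥ 0, and let v : Fin N → EuclideanSpace ℝ (Fin d) satisfy ‖v j‖ ≤ V for all j. Define softmax weights p j = exp(a j)/∑_k exp(a k) and q j = exp(b j)/∑_k exp(b k). Then (a) ∑_j |p j − q j| ≤ exp(2δ) − 1, and (b) ‖∑_j p j • v j − ∑_j q j • v j‖ ≤ (exp(2δ) − 1) · V. -/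
open scoped BigOperators

/-- Perturbing the logits by at most `δ` increases each softmax weight by a factor of at most
`exp (2 * δ)`. -/
theorem softmax_le_exp_mul_softmax {ι : Type*} [Fintype ι] {a b : ι → ℝ} {δ : ℝ}
    (hab : ∀ j, |a j - b j| ≤ δ) (j : ι) :
    Real.exp (a j) / ∑ k, Real.exp (a k) ≤
      Real.exp (2 * δ) * (Real.exp (b j) / ∑ k, Real.exp (b k)) := by
  have : Nonempty ι := ⟨j⟩
  have sum_pos (c : ι → ℝ) : 0 < ∑ k, Real.exp (c k) :=
    Finset.sum_pos (fun k _ => Real.exp_pos _) Finset.univ_nonempty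
  have num_le : Real.exp (a j) ≤ Real.exp δ * Real.exp (b j) := by
    rw [← Real.exp_add, Real.exp_le_exp]
    linarith [(abs_le.mp (hab j)).2]
  have denom_le : ∑ k, Real.exp (b k) ≤ Real.exp δ * ∑ k, Real.exp (a k) := by
    rw [Finset.mul_sum]
    refine Finset.sum_le_sum fun k _ => ?_
    rw [← Real.exp_add, Real.exp_le_exp]
    linarith [(abs_le.mp (hab k)).1]
  rw [← mul_div_assoc, div_le_div_iff₀ (sum_pos a) (sum_pos b)]
  calc Real.exp (a j) * ∑ k, Real.exp (b k)
      ≤ (Real.exp δ * Real.exp (b j)) * (Real.exp δ * ∑ k, Real.exp (a k)) :=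
        mul_le_mul num_le denom_le (sum_pos b).le (by positivity)
    _ = Real.exp (2 * δ) * Real.exp (b j) * ∑ k, Real.exp (a k) := by
        rw [two_mul, Real.exp_add]
        ring

/-- Attention output stability under logit perturbation: a uniform bound `δ` on
the logit mismatch yields a bound `exp (2δ) - 1` on the total variation of the
softmax weights and a bound `(exp (2δ) - 1) * V` on the output mismatch. -/
theorem attention_output_stability
    (N d : ℕ) (hN : 0 < N) (hd : 0 < d)
    (a b : Fin N → ℝ) (δ : ℝ) (hδ : 0 ≤ δ)
    (hab : ∀ j, |a j - b j| ≤ δ)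
    (v : Fin N → EuclideanSpace ℝ (Fin d)) (V : ℝ)
    (hv : ∀ j, ‖v j‖ ≤ V)
    (p q : Fin N → ℝ)
    (hp : ∀ j, p j = Real.exp (a j) / ∑ k, Real.exp (a k))
    (hq : ∀ j, q j = Real.exp (b j) / ∑ k, Real.exp (b k)) :
    (∑ j, |p j - q j| ≤ Real.exp (2 * δ) - 1) ∧
      ‖(∑ j, p j • v j) - ∑ j, q j • v j‖ ≤ (Real.exp (2 * δ) - 1) * V := by
  have : Nonempty (Fin N) := ⟨⟨0, hN⟩⟩
  have hpq (j : Fin N) : p j ≤ Real.exp (2 * δ) * q j := by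
    rw [hp, hq]
    exact softmax_le_exp_mul_softmax hab j
  have hqp (j : Fin N) : q j ≤ Real.exp (2 * δ) * p j := by
    rw [hp, hq]
    exact softmax_le_exp_mul_softmax (fun k => abs_sub_comm (a k) (b k) ▸ hab k) j
  have hE : 1 ≤ Real.exp (2 * δ) := Real.one_le_exp (by positivity)
  have hq_sum : ∑ j, q j = 1 := by
    simp only [hq, ← Finset.sum_div]
    exact div_self (Finset.sum_pos (fun k _ => Real.exp_pos (b k)) Finset.univ_nonempty).ne'
  have weights_le : ∑ j, |p j - q j| ≤ Real.exp (2 * δ) - 1 := by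
    calc ∑ j, |p j - q j| ≤ ∑ j, (Real.exp (2 * δ) - 1) * q j := by
          refine Finset.sum_le_sum fun j _ => abs_sub_le_iff.mpr ⟨by linarith [hpq j], ?_⟩
          have hq_nonneg : 0 ≤ q j := by
            rw [hq]
            positivity
          rcases le_total (p j) (q j) with h | h
          · nlinarith [hqp j, mul_le_mul_of_nonneg_left h (sub_nonneg.mpr hE)]
          · nlinarith [mul_nonneg (sub_nonneg.mpr hE) hq_nonneg]
      _ = Real.exp (2 * δ) - 1 := by rw [← Finset.mul_sum, hq_sum, mul_one]
  refine ⟨weights_le, ?_⟩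
  have hV : 0 ≤ V := (norm_nonneg _).trans (hv ⟨0, hN⟩)
  calc ‖(∑ j, p j • v j) - ∑ j, q j • v j‖ = ‖∑ j, (p j - q j) • v j‖ := by
        simp only [sub_smul, Finset.sum_sub_distrib]
    _ ≤ ∑ j, |p j - q j| * V := by
        refine norm_sum_le_of_le _ fun j _ => ?_
        rw [norm_smul, Real.norm_eq_abs]
        exact mul_le_mul_of_nonneg_left (hv j) (abs_nonneg _)
    _ ≤ (Real.exp (2 * δ) - 1) * V := by
        rw [← Finset.sum_mul]
        exact mul_le_mul_of_nonneg_right weights_le hV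
end

section
/- Arc-cosine kernel of the ReLU feature map: Let n be a positive natural number and let a, b ∈ EuclideanSpace ℝ (Fin n) be nonzero. Let μ be the standard Gaussian measure on (Fin n → ℝ), i.e., the product over Fin n of the Gaussian measure on ℝ with mean 0 and variance 1. Then ∫ max (⟨w, a⟩) 0 · max (⟨w, b⟩) 0 dμ(w) = (‖a‖ · ‖b‖ / (2π)) · (Real.sin θ + (π − θ) · Real.cos θ), where θ = Real.arccos(⟨a, b⟩ / (‖a‖ · ‖b‖)) is the angle between a and b. -/
open MeasureTheory ProbabilityTheory
open scoped RealInnerProductSpace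

/-- The third radial moment of the unnormalised standard Gaussian weight. -/
lemma integral_Ioi_pow_three_mul_exp_neg_half_sq :
    ∫ r in Set.Ioi (0 : ℝ), r ^ 3 * Real.exp (-r ^ 2 / 2) = 2 := by
  have h := integral_rpow_mul_exp_neg_mul_rpow (p := 2) (q := 3) (b := 1 / 2)
    (by norm_num) (by norm_num) (by norm_num)
  have h2 : ((1 : ℝ) / 2) ^ (-(3 + 1) / 2 : ℝ) * (1 / 2) * Real.Gamma ((3 + 1) / 2) = 2 := by
    rw [show (-(3 + 1) / 2 : ℝ) = ((-2 : ℤ) : ℝ) by norm_num, Real.rpow_intCast,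
      show ((3 + 1) / 2 : ℝ) = 2 by norm_num, Real.Gamma_two]
    norm_num
  rw [h2] at h
  refine Eq.trans ?_ h
  refine setIntegral_congr_fun measurableSet_Ioi fun r _ => ?_
  have e3 : r ^ (3 : ℝ) = r ^ 3 := mod_cast Real.rpow_natCast r 3
  have e2 : r ^ (2 : ℝ) = r ^ 2 := mod_cast Real.rpow_natCast r 2
  simp only [e3, e2]
  ring_nf

/-- The angular part of the arc-cosine kernel. -/
lemma integral_Ioo_max_cos_mul_max_cos_sub {θ : ℝ} (h0 : 0 ≤ θ) (hπ : θ ≤ Real.pi) :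
    ∫ φ in Set.Ioo (-Real.pi) Real.pi, max (Real.cos φ) 0 * max (Real.cos (φ - θ)) 0 =
      (Real.sin θ + (Real.pi - θ) * Real.cos θ) / 2 := by
  have hp := Real.pi_pos
  have hsub : Set.Ioo (θ - Real.pi / 2) (Real.pi / 2) ⊆ Set.Ioo (-Real.pi) Real.pi :=
    Set.Ioo_subset_Ioo (by linarith) (by linarith)
  rw [setIntegral_eq_of_subset_of_forall_sdiff_eq_zero measurableSet_Ioo hsub]
  · have hcongr : ∫ φ in Set.Ioo (θ - Real.pi / 2) (Real.pi / 2),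
        max (Real.cos φ) 0 * max (Real.cos (φ - θ)) 0 =
        ∫ φ in Set.Ioo (θ - Real.pi / 2) (Real.pi / 2), Real.cos φ * Real.cos (φ - θ) := by
      refine setIntegral_congr_fun measurableSet_Ioo fun φ hφ => ?_
      have h1 : 0 ≤ Real.cos φ :=
        Real.cos_nonneg_of_mem_Icc ⟨by linarith [hφ.1], by linarith [hφ.2]⟩
      have h2 : 0 ≤ Real.cos (φ - θ) :=
        Real.cos_nonneg_of_mem_Icc ⟨by linarith [hφ.1], by linarith [hφ.2]⟩
      simp only [max_eq_left h1, max_eq_left h2]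
    rw [hcongr, ← integral_Ioc_eq_integral_Ioo, ← intervalIntegral.integral_of_le (by linarith),
      intervalIntegral.integral_eq_sub_of_hasDerivAt
        (f := fun φ => (φ * Real.cos θ + Real.sin (2 * φ - θ) / 2) / 2)]
    · rw [show 2 * (Real.pi / 2) - θ = Real.pi - θ by ring,
        show 2 * (θ - Real.pi / 2) - θ = θ - Real.pi by ring, Real.sin_pi_sub, Real.sin_sub_pi]
      ring
    · intro φ _
      have h := ((((hasDerivAt_id φ).mul_const (Real.cos θ)).add
        ((((hasDerivAt_id φ).const_mul 2).sub_const θ).sin.div_const 2)).div_const 2)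
      refine h.congr_deriv ?_
      have e1 : Real.cos θ = Real.cos (φ - (φ - θ)) := by ring_nf
      have e2 : Real.cos (2 * φ - θ) = Real.cos (φ + (φ - θ)) := by ring_nf
      rw [id, e2, e1, Real.cos_sub φ (φ - θ), Real.cos_add φ (φ - θ)]
      ring
    · exact (by fun_prop : Continuous fun φ => Real.cos φ * Real.cos (φ - θ)).intervalIntegrable _ _
  · rintro φ ⟨hφ, hφ'⟩
    rcases le_or_gt (Real.pi / 2) φ with h | h
    · rw [max_eq_right (Real.cos_nonpos_of_pi_div_two_le_of_le h (by linarith [hφ.2])), zero_mul]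
    have h' : φ ≤ θ - Real.pi / 2 := not_lt.mp fun h' => hφ' ⟨h', h⟩
    rcases le_or_gt φ (-(Real.pi / 2)) with h2 | h2
    · rw [max_eq_right, zero_mul]
      rw [← Real.cos_neg]
      exact Real.cos_nonpos_of_pi_div_two_le_of_le (by linarith) (by linarith [hφ.1])
    · rw [max_eq_right (a := Real.cos (φ - θ)), mul_zero]
      rw [← Real.cos_neg]
      exact Real.cos_nonpos_of_pi_div_two_le_of_le (by linarith) (by linarith [hφ.1])

/-- The product of two standard Gaussians integrated in polar coordinates. -/
lemma integral_gaussianReal_prod_eq_polarCoord (f : ℝ × ℝ → ℝ) :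
    ∫ p, f p ∂((gaussianReal 0 1).prod (gaussianReal 0 1)) =
      ∫ p in Set.Ioi (0 : ℝ) ×ˢ Set.Ioo (-Real.pi) Real.pi,
        p.1 * ((2 * Real.pi)⁻¹ * Real.exp (-p.1 ^ 2 / 2) *
          f (p.1 * Real.cos p.2, p.1 * Real.sin p.2)) := by
  rw [gaussianReal_of_var_ne_zero 0 one_ne_zero,
    prod_withDensity (measurable_gaussianPDF 0 1) (measurable_gaussianPDF 0 1),
    integral_withDensity_eq_integral_toReal_smul (by fun_prop)
      (ae_of_all _ fun _ => ENNReal.mul_lt_top gaussianPDF_lt_top gaussianPDF_lt_top),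
    ← Measure.volume_eq_prod, ← integral_comp_polarCoord_symm, polarCoord_target]
  refine setIntegral_congr_fun (measurableSet_Ioi.prod measurableSet_Ioo) fun p _ => ?_
  have h1 : Real.exp (-(p.1 * Real.cos p.2) ^ 2 / 2) * Real.exp (-(p.1 * Real.sin p.2) ^ 2 / 2) =
      Real.exp (-p.1 ^ 2 / 2) := by
    rw [← Real.exp_add]
    congr 1
    linear_combination (-p.1 ^ 2 / 2) * Real.sin_sq_add_cos_sq p.2
  have h2 : (Real.sqrt (2 * Real.pi))⁻¹ * (Real.sqrt (2 * Real.pi))⁻¹ = (2 * Real.pi)⁻¹ := by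
    rw [← mul_inv, Real.mul_self_sqrt (by positivity)]
  simp only [polarCoord_symm_apply, ENNReal.toReal_mul, toReal_gaussianPDF, gaussianPDFReal,
    smul_eq_mul, NNReal.coe_one, mul_one, sub_zero]
  rw [← h1, ← h2]
  ring

/-- The arc-cosine kernel for unit vectors at angle `θ` in the plane. -/
lemma integral_gaussianReal_prod_max_mul_max {θ : ℝ} (h0 : 0 ≤ θ) (hπ : θ ≤ Real.pi) :
    ∫ p : ℝ × ℝ, max p.1 0 * max (Real.cos θ * p.1 + Real.sin θ * p.2) 0
        ∂((gaussianReal 0 1).prod (gaussianReal 0 1)) =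
      (2 * Real.pi)⁻¹ * (Real.sin θ + (Real.pi - θ) * Real.cos θ) := by
  have hcongr : ∀ p ∈ Set.Ioi (0 : ℝ) ×ˢ Set.Ioo (-Real.pi) Real.pi,
      p.1 * ((2 * Real.pi)⁻¹ * Real.exp (-p.1 ^ 2 / 2) * (max (p.1 * Real.cos p.2) 0 *
        max (Real.cos θ * (p.1 * Real.cos p.2) + Real.sin θ * (p.1 * Real.sin p.2)) 0)) =
      (2 * Real.pi)⁻¹ * ((p.1 ^ 3 * Real.exp (-p.1 ^ 2 / 2)) *
        (max (Real.cos p.2) 0 * max (Real.cos (p.2 - θ)) 0)) := by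
    rintro ⟨r, φ⟩ ⟨hr, -⟩
    have hr : 0 ≤ r := le_of_lt hr
    have e1 : max (r * Real.cos φ) 0 = r * max (Real.cos φ) 0 := by
      rw [mul_max_of_nonneg _ _ hr, mul_zero]
    have e2 : max (Real.cos θ * (r * Real.cos φ) + Real.sin θ * (r * Real.sin φ)) 0 =
        r * max (Real.cos (φ - θ)) 0 := by
      rw [mul_max_of_nonneg _ _ hr, mul_zero, Real.cos_sub]
      ring_nf
    simp only [e1, e2]
    ring
  rw [integral_gaussianReal_prod_eq_polarCoord,
    setIntegral_congr_fun (measurableSet_Ioi.prod measurableSet_Ioo) hcongr,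
    integral_const_mul, Measure.volume_eq_prod,
    setIntegral_prod_mul (fun r : ℝ => r ^ 3 * Real.exp (-r ^ 2 / 2))
      (fun φ => max (Real.cos φ) 0 * max (Real.cos (φ - θ)) 0),
    integral_Ioi_pow_three_mul_exp_neg_half_sq, integral_Ioo_max_cos_mul_max_cos_sub h0 hπ]
  ring

lemma charFunDual_gaussianReal_zero_one (L : StrongDual ℝ ℝ) :
    charFunDual (gaussianReal 0 1) L = Complex.exp (-(L 1) ^ 2 / 2) := by
  have h : ⇑L = fun x => L 1 * x := by
    ext x
    rw [mul_comm, ← smul_eq_mul, ← map_smul, smul_eq_mul, mul_one]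
  rw [charFunDual_eq_charFun_map_one, h, gaussianReal_map_const_mul, charFun_gaussianReal]
  simp [neg_div]

/-- The joint law of two linear functionals of a standard Gaussian vector, written in terms of two
independent standard Gaussians by means of the Cholesky factor of their covariance. -/
lemma map_inner_inner_stdGaussian {E : Type*} [NormedAddCommGroup E] [InnerProductSpace ℝ E]
    [FiniteDimensional ℝ E] [MeasurableSpace E] [BorelSpace E] {a b : E} {α β γ : ℝ}
    (haa : ‖a‖ ^ 2 = α ^ 2) (hab : ⟪a, b⟫ = α * β) (hbb : ‖b‖ ^ 2 = β ^ 2 + γ ^ 2) :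
    (stdGaussian E).map (fun w => (⟪w, a⟫, ⟪w, b⟫)) =
      ((gaussianReal 0 1).prod (gaussianReal 0 1)).map
        (fun p : ℝ × ℝ => (α * p.1, β * p.1 + γ * p.2)) := by
  let S : E →L[ℝ] ℝ × ℝ := (innerSL ℝ a).prod (innerSL ℝ b)
  let T : ℝ × ℝ →L[ℝ] ℝ × ℝ := (α • ContinuousLinearMap.fst ℝ ℝ ℝ).prod
    (β • ContinuousLinearMap.fst ℝ ℝ ℝ + γ • ContinuousLinearMap.snd ℝ ℝ ℝ)
  have hS : (fun w => (⟪w, a⟫, ⟪w, b⟫)) = S := by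
    ext w <;> simp [S, real_inner_comm]
  have hT : (fun p : ℝ × ℝ => (α * p.1, β * p.1 + γ * p.2)) = T := by
    ext p <;> simp [T]
  rw [hS, hT]
  have := Measure.isProbabilityMeasure_map (μ := stdGaussian E) (f := S) (by fun_prop)
  have := Measure.isProbabilityMeasure_map
    (μ := (gaussianReal 0 1).prod (gaussianReal 0 1)) (f := T) (by fun_prop)
  refine Measure.ext_of_charFunDual (funext fun L => ?_)
  have hL (x y : ℝ) : L (x, y) = L (1, 0) * x + L (0, 1) * y := by
    have : ((x, y) : ℝ × ℝ) = x • (1, 0) + y • (0, 1) := by simp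
    rw [this, map_add, map_smul, map_smul, smul_eq_mul, smul_eq_mul]
    ring
  have hLS : L.comp S = innerSL ℝ (L (1, 0) • a + L (0, 1) • b) := by
    ext w
    simp [S, hL ⟪a, w⟫]
  rw [charFunDual_map, charFunDual_map, charFunDual_stdGaussian, charFunDual_prod,
    charFunDual_gaussianReal_zero_one, charFunDual_gaussianReal_zero_one, hLS, innerSL_apply_norm,
    ← Complex.exp_add]
  congr 1
  simp only [ContinuousLinearMap.comp_apply, ContinuousLinearMap.inl_apply,
    ContinuousLinearMap.inr_apply]
  have h1 : T (1, 0) = (α, β) := by simp [T]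
  have h2 : T (0, 1) = (0, γ) := by simp [T]
  rw [h1, h2, hL α β, hL 0 γ]
  norm_cast
  rw [norm_add_sq_real, real_inner_smul_left, real_inner_smul_right, norm_smul, norm_smul, mul_pow,
    mul_pow, haa, hab, hbb, Real.norm_eq_abs, Real.norm_eq_abs, sq_abs, sq_abs]
  ring

/-- Arc-cosine kernel of the ReLU feature map: the expectation over a standard
Gaussian vector `w` of `ReLU ⟪w, a⟫ * ReLU ⟪w, b⟫` equals the first-order
arc-cosine kernel `(‖a‖ ‖b‖ / (2π)) (sin θ + (π − θ) cos θ)`, where `θ` is the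
angle between `a` and `b`. -/
theorem arc_cosine_kernel_relu
    (n : ℕ) (hn : 0 < n)
    (a b : EuclideanSpace ℝ (Fin n)) (ha : a ≠ 0) (hb : b ≠ 0) :
    ∫ w : Fin n → ℝ,
        max ⟪(EuclideanSpace.equiv (Fin n) ℝ).symm w, a⟫ 0 *
          max ⟪(EuclideanSpace.equiv (Fin n) ℝ).symm w, b⟫ 0
        ∂(Measure.pi fun _ : Fin n => gaussianReal 0 1) =
      (‖a‖ * ‖b‖ / (2 * Real.pi)) *
        (Real.sin (Real.arccos (⟪a, b⟫ / (‖a‖ * ‖b‖))) +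
          (Real.pi - Real.arccos (⟪a, b⟫ / (‖a‖ * ‖b‖))) *
            Real.cos (Real.arccos (⟪a, b⟫ / (‖a‖ * ‖b‖)))) := by
  have hcos : ⟪a, b⟫ = ‖a‖ * (‖b‖ * Real.cos (Real.arccos (⟪a, b⟫ / (‖a‖ * ‖b‖)))) := by
    have h := InnerProductGeometry.cos_angle_mul_norm_mul_norm a b
    rw [InnerProductGeometry.angle] at h
    linear_combination -h
  have h0 := Real.arccos_nonneg (⟪a, b⟫ / (‖a‖ * ‖b‖))
  have hπ := Real.arccos_le_pi (⟪a, b⟫ / (‖a‖ * ‖b‖))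
  generalize Real.arccos (⟪a, b⟫ / (‖a‖ * ‖b‖)) = θ at *
  have hlaw := map_inner_inner_stdGaussian (γ := ‖b‖ * Real.sin θ) rfl hcos
    (by linear_combination -‖b‖ ^ 2 * Real.sin_sq_add_cos_sq θ)
  have hf : Continuous fun p : ℝ × ℝ => max p.1 0 * max p.2 0 := by fun_prop
  have hrelu (p : ℝ × ℝ) : max (‖a‖ * p.1) 0 *
      max (‖b‖ * Real.cos θ * p.1 + ‖b‖ * Real.sin θ * p.2) 0 =
      (‖a‖ * ‖b‖) * (max p.1 0 * max (Real.cos θ * p.1 + Real.sin θ * p.2) 0) := by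
    have e1 := mul_max_of_nonneg p.1 0 (norm_nonneg a)
    have e2 := mul_max_of_nonneg (Real.cos θ * p.1 + Real.sin θ * p.2) 0 (norm_nonneg b)
    rw [mul_zero] at e1 e2
    rw [← e1, mul_assoc ‖b‖, mul_assoc ‖b‖, ← mul_add, ← e2]
    ring
  calc
    _ = ∫ w, max ⟪w, a⟫ 0 * max ⟪w, b⟫ 0 ∂(stdGaussian (EuclideanSpace ℝ (Fin n))) := by
      rw [← map_pi_eq_stdGaussian, integral_map (by fun_prop) (by fun_prop)]
      rfl
    _ = ∫ p, max p.1 0 * max p.2 0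
          ∂((stdGaussian (EuclideanSpace ℝ (Fin n))).map fun w => (⟪w, a⟫, ⟪w, b⟫)) := by
      rw [integral_map (by fun_prop) hf.aestronglyMeasurable]
    _ = ∫ p : ℝ × ℝ, (‖a‖ * ‖b‖) * (max p.1 0 * max (Real.cos θ * p.1 + Real.sin θ * p.2) 0)
          ∂((gaussianReal 0 1).prod (gaussianReal 0 1)) := by
      rw [hlaw, integral_map (by fun_prop) hf.aestronglyMeasurable]
      exact integral_congr_ae (ae_of_all _ hrelu)
    _ = _ := by
      rw [integral_const_mul, integral_gaussianReal_prod_max_mul_max h0 hπ]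
      ring
end

section
/- Finite Johnson–Lindenstrauss embedding lemma: There exists a constant c > 0 such that for every ε ∈ (0,1), every positive natural number d, every finite set S of vectors in EuclideanSpace ℝ (Fin d) with cardinality N ≥ 2, and every positive natural number r with (r : ℝ) ≥ c · ε⁻² · Real.log N, there exists a linear map f : EuclideanSpace ℝ (Fin d) →ₗ[ℝ] EuclideanSpace ℝ (Fin r) such that for all x, y ∈ S: (1 − ε) · ‖x − y‖² ≤ ‖f x − f y‖² ≤ (1 + ε) · ‖x − y‖². -/
open MeasureTheory ProbabilityTheory

/-- A quadratic lower bound for `log (1 - s)` near zero, in exponential form. -/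
lemma exp_neg_add_sq_le_one_sub {s : ℝ} (hs : |s| ≤ 1 / 2) : Real.exp (-(s + s ^ 2)) ≤ 1 - s := by
  obtain ⟨h1, h2⟩ := abs_le.1 hs
  have key : 1 ≤ (1 - s) * Real.exp (s + s ^ 2) := by
    rcases le_total s 0 with h | h
    · have h3 := Real.add_one_le_exp (s + s ^ 2)
      have h4 : s ^ 3 ≤ 0 := by nlinarith [sq_nonneg s]
      nlinarith
    · have h3 := Real.quadratic_le_exp_of_nonneg (x := s + s ^ 2) (by positivity)
      have h4 : 0 ≤ 1 - s - s ^ 2 - s ^ 3 := by nlinarith [pow_le_pow_left₀ h h2 3]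
      have h5 : 0 ≤ s ^ 2 * (1 - s - s ^ 2 - s ^ 3) := by positivity
      nlinarith [mul_le_mul_of_nonneg_left h3 (by linarith : 0 ≤ 1 - s)]
  rw [Real.exp_neg, inv_le_iff_one_le_mul₀ (Real.exp_pos _)]
  exact key

lemma gaussianPDFReal_smul_exp_sq (t x : ℝ) :
    gaussianPDFReal 0 1 x • Real.exp (t * (x ^ 2 - 1)) =
      (√(2 * Real.pi))⁻¹ * Real.exp (-t) * Real.exp (-(1 / 2 - t) * x ^ 2) := by
  simp only [gaussianPDFReal, smul_eq_mul, NNReal.coe_one, mul_one]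
  rw [mul_assoc, mul_assoc, ← Real.exp_add, ← Real.exp_add]
  congr 2
  ring

lemma integrable_exp_sq_gaussianReal {t : ℝ} (ht : t < 1 / 2) :
    Integrable (fun x ↦ Real.exp (t * (x ^ 2 - 1))) (gaussianReal 0 1) := by
  rw [gaussianReal_of_var_ne_zero 0 one_ne_zero,
    integrable_withDensity_iff_integrable_smul' (measurable_gaussianPDF _ _)
      (ae_of_all _ fun _ ↦ gaussianPDF_lt_top)]
  simp_rw [toReal_gaussianPDF, gaussianPDFReal_smul_exp_sq]
  exact (integrable_exp_neg_mul_sq (by linarith)).const_mul _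

/-- The centered square of a standard Gaussian variable is locally sub-Gaussian. -/
lemma integral_exp_sq_gaussianReal_le {t : ℝ} (ht : |t| ≤ 1 / 4) :
    ∫ x, Real.exp (t * (x ^ 2 - 1)) ∂gaussianReal 0 1 ≤ Real.exp (2 * t ^ 2) := by
  obtain ⟨h1, h2⟩ := abs_le.1 ht
  have hpos : 0 < 1 - 2 * t := by linarith
  have hlog := exp_neg_add_sq_le_one_sub (s := 2 * t) (by rw [abs_mul, abs_two]; linarith)
  have hsqrt : Real.exp (-(t + 2 * t ^ 2)) ≤ √(1 - 2 * t) := by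
    apply Real.le_sqrt_of_sq_le
    rw [← Real.exp_nat_mul]
    refine le_of_eq_of_le ?_ hlog
    push_cast
    ring_nf
  rw [integral_gaussianReal_eq_integral_smul one_ne_zero]
  simp_rw [gaussianPDFReal_smul_exp_sq]
  rw [integral_const_mul, integral_gaussian,
    show Real.pi / (1 / 2 - t) = (2 * Real.pi) / (1 - 2 * t) by field_simp,
    Real.sqrt_div (by positivity)]
  have hpi : 0 < √(2 * Real.pi) := by positivity
  calc (√(2 * Real.pi))⁻¹ * Real.exp (-t) * (√(2 * Real.pi) / √(1 - 2 * t))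
      = Real.exp (-t) / √(1 - 2 * t) := by field_simp
    _ ≤ Real.exp (-t) / Real.exp (-(t + 2 * t ^ 2)) := by gcongr
    _ = Real.exp (2 * t ^ 2) := by
      rw [← Real.exp_sub]
      ring_nf

lemma exp_sum_inner_sq {E ι : Type*} [NormedAddCommGroup E] [InnerProductSpace ℝ E] [Fintype ι]
    (u : E) (t : ℝ) (ω : ι → E) :
    Real.exp (t * (∑ i, inner ℝ u (ω i) ^ 2 - Fintype.card ι)) =
      ∏ i, Real.exp (t * (inner ℝ u (ω i) ^ 2 - 1)) := by
  rw [← Real.exp_sum, ← Finset.mul_sum, Finset.sum_sub_distrib]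
  simp

section StdGaussian

variable {E : Type*} [NormedAddCommGroup E] [InnerProductSpace ℝ E] [FiniteDimensional ℝ E]
  [MeasurableSpace E] [BorelSpace E]

lemma map_inner_stdGaussian {u : E} (hu : ‖u‖ = 1) :
    (stdGaussian E).map (innerSL ℝ u) = gaussianReal 0 1 := by
  rw [IsGaussian.map_eq_gaussianReal, integral_strongDual_stdGaussian, variance_dual_stdGaussian,
    innerSL_apply_norm, hu]
  simp

variable {ι : Type*} [Fintype ι]

lemma integrable_exp_sum_inner_sq {u : E} (hu : ‖u‖ = 1) {t : ℝ} (ht : t < 1 / 2) :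
    Integrable (fun ω : ι → E ↦ Real.exp (t * (∑ i, inner ℝ u (ω i) ^ 2 - Fintype.card ι)))
      (Measure.pi fun _ ↦ stdGaussian E) := by
  simp_rw [exp_sum_inner_sq]
  refine Integrable.fintype_prod (f := fun _ x ↦ Real.exp (t * (inner ℝ u x ^ 2 - 1))) fun _ ↦ ?_
  have h := integrable_exp_sq_gaussianReal ht
  rw [← map_inner_stdGaussian hu] at h
  exact h.comp_measurable (innerSL ℝ u).continuous.measurable

lemma integral_exp_sum_inner_sq_le {u : E} (hu : ‖u‖ = 1) {t : ℝ} (ht : |t| ≤ 1 / 4) :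
    ∫ ω : ι → E, Real.exp (t * (∑ i, inner ℝ u (ω i) ^ 2 - Fintype.card ι))
      ∂(Measure.pi fun _ ↦ stdGaussian E) ≤ Real.exp (2 * t ^ 2 * Fintype.card ι) := by
  simp_rw [exp_sum_inner_sq]
  rw [integral_fintype_prod_eq_pow (fun x : E ↦ Real.exp (t * (inner ℝ u x ^ 2 - 1))),
    mul_comm (2 * t ^ 2), Real.exp_nat_mul]
  refine pow_le_pow_left₀ (integral_nonneg fun _ ↦ (Real.exp_pos _).le) ?_ _
  refine le_of_eq_of_le ?_ (integral_exp_sq_gaussianReal_le ht)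
  rw [← map_inner_stdGaussian hu, integral_map (innerSL ℝ u).continuous.aemeasurable
    (Measurable.aestronglyMeasurable (by fun_prop))]
  rfl

/-- Given few unit vectors, some family of vectors has squared correlations with each of them
summing to nearly the size of the family. -/
lemma exists_abs_sum_inner_sq_sub_card_le (T : Finset E) (hT : ∀ u ∈ T, ‖u‖ = 1) {ε : ℝ}
    (hε : ε ∈ Set.Ioo (0 : ℝ) 1)
    (hcard : 2 * (T.card : ℝ) * Real.exp (-(ε ^ 2 * Fintype.card ι / 8)) < 1) :
    ∃ ω : ι → E, ∀ u ∈ T,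
      |∑ i, inner ℝ u (ω i) ^ 2 - Fintype.card ι| ≤ ε * Fintype.card ι := by
  obtain ⟨hε0, hε1⟩ := hε
  set r : ℝ := (Fintype.card ι : ℝ)
  have ht : |ε / 4| ≤ 1 / 4 := by rw [abs_of_pos (by positivity)]; linarith
  have ht' : |-(ε / 4)| ≤ 1 / 4 := by rwa [abs_neg]
  let F : E → (ι → E) → ℝ := fun u ω ↦
    Real.exp (ε / 4 * (∑ i, inner ℝ u (ω i) ^ 2 - r)) +
      Real.exp (-(ε / 4) * (∑ i, inner ℝ u (ω i) ^ 2 - r))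
  have hF : ∀ u ∈ T, Integrable (F u) (Measure.pi fun _ ↦ stdGaussian E) := fun u hu ↦
    (integrable_exp_sum_inner_sq (hT u hu) (by linarith)).add
      (integrable_exp_sum_inner_sq (hT u hu) (by linarith))
  obtain ⟨ω, hω⟩ := exists_le_integral (integrable_finsetSum T hF)
  have hbound : ∫ ω, ∑ u ∈ T, F u ω ∂(Measure.pi fun _ : ι ↦ stdGaussian E) <
      Real.exp (ε / 4 * (ε * r)) := by
    rw [integral_finsetSum _ hF]
    have hle : ∀ u ∈ T, ∫ ω, F u ω ∂(Measure.pi fun _ : ι ↦ stdGaussian E) ≤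
        2 * Real.exp (ε ^ 2 * r / 8) := by
      intro u hu
      have h1 := integral_exp_sum_inner_sq_le (ι := ι) (hT u hu) ht
      have h2 := integral_exp_sum_inner_sq_le (ι := ι) (hT u hu) ht'
      rw [show 2 * (ε / 4) ^ 2 * (Fintype.card ι : ℝ) = ε ^ 2 * r / 8 by ring] at h1
      rw [show 2 * (-(ε / 4)) ^ 2 * (Fintype.card ι : ℝ) = ε ^ 2 * r / 8 by ring] at h2
      rw [integral_add (integrable_exp_sum_inner_sq (hT u hu) (by linarith))
        (integrable_exp_sum_inner_sq (hT u hu) (by linarith))]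
      linarith
    calc ∑ u ∈ T, ∫ ω, F u ω ∂(Measure.pi fun _ : ι ↦ stdGaussian E)
        ≤ T.card * (2 * Real.exp (ε ^ 2 * r / 8)) := by
          simpa using Finset.sum_le_card_nsmul T _ _ hle
      _ = 2 * T.card * Real.exp (-(ε ^ 2 * r / 8)) * Real.exp (ε / 4 * (ε * r)) := by
          rw [mul_assoc (2 * (T.card : ℝ)), ← Real.exp_add]
          ring_nf
      _ < 1 * Real.exp (ε / 4 * (ε * r)) := by gcongr
      _ = _ := one_mul _
  refine ⟨ω, fun u hu ↦ ?_⟩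
  have hFu : F u ω < Real.exp (ε / 4 * (ε * r)) :=
    (Finset.single_le_sum (f := fun u ↦ F u ω) (fun v _ ↦ by positivity) hu).trans_lt
      (hω.trans_lt hbound)
  have hpos : 0 < ε / 4 := by positivity
  have hupper := Real.exp_lt_exp.1 ((lt_add_of_pos_right _ (Real.exp_pos _)).trans hFu)
  have hlower := Real.exp_lt_exp.1 ((lt_add_of_pos_left _ (Real.exp_pos _)).trans hFu)
  rw [abs_le]
  constructor <;> nlinarith

end StdGaussian

/-- The linear map `x ↦ (√r)⁻¹ • (⟪ω i, x⟫)ᵢ`. -/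
noncomputable def scaledInnerMap {E : Type*} [NormedAddCommGroup E] [InnerProductSpace ℝ E] {r : ℕ}
    (ω : Fin r → E) : E →ₗ[ℝ] EuclideanSpace ℝ (Fin r) :=
  (√r)⁻¹ • ((WithLp.linearEquiv 2 ℝ (Fin r → ℝ)).symm.toLinearMap ∘ₗ
    LinearMap.pi fun i ↦ (innerSL ℝ (ω i)).toLinearMap)

lemma norm_scaledInnerMap_sq {E : Type*} [NormedAddCommGroup E] [InnerProductSpace ℝ E] {r : ℕ}
    (ω : Fin r → E) (x : E) :
    ‖scaledInnerMap ω x‖ ^ 2 = (r : ℝ)⁻¹ * ∑ i, inner ℝ x (ω i) ^ 2 := by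
  rw [scaledInnerMap, LinearMap.smul_apply, norm_smul, mul_pow, EuclideanSpace.real_norm_sq_eq]
  simp [real_inner_comm]

/-- Control of the squared correlations with `x / ‖x‖` controls the distortion at `x`. -/
lemma norm_scaledInnerMap_sq_mem_Icc {E : Type*} [NormedAddCommGroup E] [InnerProductSpace ℝ E]
    {r : ℕ} (hr : 0 < r) {ω : Fin r → E} {x : E} (hx : x ≠ 0) {ε : ℝ}
    (h : |∑ i, inner ℝ (‖x‖⁻¹ • x) (ω i) ^ 2 - r| ≤ ε * r) :
    ‖scaledInnerMap ω x‖ ^ 2 ∈ Set.Icc ((1 - ε) * ‖x‖ ^ 2) ((1 + ε) * ‖x‖ ^ 2) := by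
  have hr' : (0 : ℝ) < r := by exact_mod_cast hr
  have hx' : 0 < ‖x‖ := norm_pos_iff.2 hx
  set Z := ∑ i, inner ℝ (‖x‖⁻¹ • x) (ω i) ^ 2 with hZ
  have hsum : ‖scaledInnerMap ω x‖ ^ 2 = (Z / r) * ‖x‖ ^ 2 := by
    rw [norm_scaledInnerMap_sq, hZ]
    simp_rw [real_inner_smul_left, mul_pow, ← Finset.mul_sum]
    field_simp
  obtain ⟨h1, h2⟩ := abs_le.1 h
  rw [hsum]
  constructor
  · gcongr
    rw [le_div_iff₀ hr']
    linarith
  · gcongr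
    rw [div_le_iff₀ hr']
    linarith

/-- Finite Johnson–Lindenstrauss embedding lemma: there is a constant `c > 0`
such that any `N ≥ 2` points of a Euclidean space can be mapped by a linear map
into a Euclidean space of any dimension `r ≥ c ε⁻² log N` with all pairwise
squared distances distorted by at most a factor `1 ± ε`. -/
theorem finite_johnson_lindenstrauss :
    ∃ c : ℝ, 0 < c ∧
      ∀ ε : ℝ, ε ∈ Set.Ioo (0 : ℝ) 1 →
        ∀ d : ℕ, 0 < d →
          ∀ S : Finset (EuclideanSpace ℝ (Fin d)), 2 ≤ S.card →
            ∀ r : ℕ, 0 < r →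
              (r : ℝ) ≥ c * ε⁻¹ ^ 2 * Real.log S.card →
                ∃ f : EuclideanSpace ℝ (Fin d) →ₗ[ℝ] EuclideanSpace ℝ (Fin r),
                  ∀ x ∈ S, ∀ y ∈ S,
                    (1 - ε) * ‖x - y‖ ^ 2 ≤ ‖f x - f y‖ ^ 2 ∧
                      ‖f x - f y‖ ^ 2 ≤ (1 + ε) * ‖x - y‖ ^ 2 := by
  classical
  refine ⟨32, by norm_num, fun ε hε d _ S hS r hr hrS ↦ ?_⟩
  let T := S.offDiag.image fun p ↦ ‖p.1 - p.2‖⁻¹ • (p.1 - p.2)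
  have hN : (2 : ℝ) ≤ S.card := by exact_mod_cast hS
  have hT : ∀ u ∈ T, ‖u‖ = 1 := by
    intro u hu
    obtain ⟨p, hp, rfl⟩ := Finset.mem_image.1 hu
    exact norm_smul_inv_norm (𝕜 := ℝ) (sub_ne_zero.2 (Finset.mem_offDiag.1 hp).2.2)
  have hTcard : (T.card : ℝ) ≤ (S.card : ℝ) ^ 2 := by
    have h : T.card ≤ S.card * S.card :=
      Finset.card_image_le.trans (S.offDiag_card.trans_le (Nat.sub_le _ _))
    rw [sq]
    exact_mod_cast h
  have hexp : Real.exp (-(ε ^ 2 * r / 8)) ≤ ((S.card : ℝ) ^ 4)⁻¹ := by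
    rw [Real.exp_neg]
    gcongr
    rw [← Real.exp_log (by positivity : (0 : ℝ) < (S.card : ℝ) ^ 4), Real.log_pow]
    gcongr
    have hε0 : ε ≠ 0 := hε.1.ne'
    have h := mul_le_mul_of_nonneg_left hrS (sq_nonneg ε)
    rw [show ε ^ 2 * (32 * ε⁻¹ ^ 2 * Real.log S.card) = 32 * Real.log S.card by field_simp] at h
    push_cast
    linarith
  obtain ⟨ω, hω⟩ := exists_abs_sum_inner_sq_sub_card_le (ι := Fin r) T hT hε (by
    rw [Fintype.card_fin]
    calc 2 * (T.card : ℝ) * Real.exp (-(ε ^ 2 * r / 8))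
        ≤ 2 * (S.card : ℝ) ^ 2 * ((S.card : ℝ) ^ 4)⁻¹ := by gcongr
      _ = 2 / (S.card : ℝ) ^ 2 := by field_simp
      _ < 1 := by
        rw [div_lt_one (by positivity)]
        nlinarith)
  refine ⟨scaledInnerMap ω, fun x hx y hy ↦ ?_⟩
  rw [← map_sub]
  by_cases hxy : x = y
  · simp [hxy]
  have hmem : ‖x - y‖⁻¹ • (x - y) ∈ T :=
    Finset.mem_image.2 ⟨(x, y), Finset.mem_offDiag.2 ⟨hx, hy, hxy⟩, rfl⟩
  have h := hω _ hmem
  rw [Fintype.card_fin] at h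
  exact norm_scaledInnerMap_sq_mem_Icc hr (sub_ne_zero.2 hxy) h
end
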